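/- arXiv:1207.6699 — 2 statements merged into one kernel-verified Lean document; each statement's English description precedes it below -/
import Mathlib

section
/- Let X and Y be Tychonoff spaces and suppose there is a continuous open surjection from C_p(X) onto C_p(Y). Then there exist, for every integer n ≥ 1, a subspace Z_n of the product space X^n × Y, a locally closed subspace B_n of Z_n, and a locally closed subspace Y_n of Y, such that: each Z_n admits a perfect finite-to-one continuous surjection onto a closed subspace of X^n; each Y_n is the image of B_n under a perfect finite-to-one continuous surjection; and Y = ⋃_{n≥1} Y_n. -/
/-- `Cp X` is the space `C(X, ℝ)` of continuous real-valued functions on `X`,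
topologized as a subspace of the product `X → ℝ`, i.e. with the topology of
pointwise convergence. -/
def Cp (X : Type*) [TopologicalSpace X] : Type _ := {f : X → ℝ // Continuous f}

instance (X : Type*) [TopologicalSpace X] : TopologicalSpace (Cp X) :=
  inferInstanceAs (TopologicalSpace {f : X → ℝ // Continuous f})

namespace Okunev
open Set Filter Topology

variable {X : Type*} {Y : Type*} [TopologicalSpace X] [TopologicalSpace Y]

theorem mem_nhds_Cp (f : Cp X) (U : Set (Cp X)) (hU : U ∈ 𝓝 f) :
    ∃ A : Finset X, ∃ ε > 0, ∀ g : Cp X, (∀ a ∈ A, |g.1 a - f.1 a| < ε) → g ∈ U := by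
  have h1 : U ∈ Filter.comap (fun g : Cp X => g.1) (𝓝 f.1) := by
    have h0 := nhds_induced (fun g : Cp X => g.1) f
    rw [← h0]; exact hU
  obtain ⟨V, hV, hVU⟩ := h1
  rw [nhds_pi, Filter.mem_pi] at hV
  obtain ⟨I, hI, t, ht, hIt⟩ := hV
  have h2 : ∀ i, ∃ ε > 0, Metric.ball (f.1 i) ε ⊆ t i := fun i => Metric.mem_nhds_iff.1 (ht i)
  choose e he het using h2
  obtain ⟨ε, hε, hεe⟩ : ∃ ε > 0, ∀ i ∈ I, ε ≤ e i := by
    rcases hI.toFinset.eq_empty_or_nonempty with h0 | h0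
    · refine ⟨1, one_pos, fun i hi => ?_⟩
      have : i ∈ hI.toFinset := by simpa using hi
      rw [h0] at this; simp at this
    · refine ⟨hI.toFinset.inf' h0 e, ?_, fun i hi => ?_⟩
      · exact (Finset.lt_inf'_iff _).2 fun i _ => he i
      · exact Finset.inf'_le _ (by simpa using hi)
  refine ⟨hI.toFinset, ε, hε, fun g hg => hVU (hIt fun i hi => het i ?_)⟩
  rw [Metric.mem_ball, Real.dist_eq]
  exact (hg i (by simpa using hi)).trans_le (hεe i hi)

theorem nhds_Cp_mem (f : Cp X) (A : Finset X) (ε : ℝ) (hε : 0 < ε) :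
    {g : Cp X | ∀ a ∈ A, |g.1 a - f.1 a| < ε} ∈ 𝓝 f := by
  have : IsOpen {g : Cp X | ∀ a ∈ A, |g.1 a - f.1 a| < ε} := by
    have : {g : Cp X | ∀ a ∈ A, |g.1 a - f.1 a| < ε} =
      ⋂ a ∈ A, {g : Cp X | |g.1 a - f.1 a| < ε} := by ext; simp
    rw [this]
    refine isOpen_biInter_finset fun a _ => isOpen_lt ?_ continuous_const
    have : Continuous fun g : Cp X => g.1 a := (continuous_apply a).comp continuous_subtype_val
    exact (this.sub continuous_const).abs
  exact this.mem_nhds (by simp [hε])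

structure OkHyp (h : C(X, ℝ) → C(Y, ℝ)) : Prop where
  cont : ∀ f y, 1 < |h f y| → ∃ A : Finset X, ∀ g : C(X, ℝ), (∀ a ∈ A, g a = f a) → 1 < |h g y|
  cont0 : ∀ y, ∃ A : Finset X, ∃ ε > 0, ∀ g : C(X, ℝ), (∀ a ∈ A, |g a| < ε) → |h g y| ≤ 1
  opn : ∀ (S : Finset X) (ε : ℝ), 0 < ε → ∃ B : Finset Y, ∀ g : C(Y, ℝ), (∀ b ∈ B, g b = 0) →
    ∃ f : C(X, ℝ), (∀ x ∈ S, |f x| < ε) ∧ h f = g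
  surj : Function.Surjective h

theorem exists_okHyp (hΦ : ∃ Φ : Cp X → Cp Y, Continuous Φ ∧ IsOpenMap Φ ∧ Function.Surjective Φ) :
    ∃ h : C(X, ℝ) → C(Y, ℝ), OkHyp h := by
  obtain ⟨Φ, hc, ho, hs⟩ := hΦ
  obtain ⟨f0, hf0⟩ := hs ⟨fun _ => 0, continuous_const⟩
  let j : C(X, ℝ) → Cp X := fun f => ⟨fun x => f x + f0.1 x, f.continuous.add f0.2⟩
  have hev : ∀ y, Continuous fun f : Cp X => |(Φ f).1 y| := fun y =>
    ((continuous_apply y).comp (continuous_subtype_val.comp hc)).abs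
  refine ⟨fun f => ⟨(Φ (j f)).1, (Φ (j f)).2⟩, ?_, ?_, ?_, ?_⟩
  · intro f y hy
    have : {g : Cp X | 1 < |(Φ g).1 y|} ∈ 𝓝 (j f) :=
      (isOpen_lt continuous_const (hev y)).mem_nhds hy
    obtain ⟨A, ε, hε, hA⟩ := mem_nhds_Cp _ _ this
    exact ⟨A, fun g hg => hA (j g) fun a ha => by simp [j, hg a ha, hε]⟩
  · intro y
    have : {g : Cp X | |(Φ g).1 y| < 1} ∈ 𝓝 f0 :=
      (isOpen_lt (hev y) continuous_const).mem_nhds (by simp [hf0])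
    obtain ⟨A, ε, hε, hA⟩ := mem_nhds_Cp _ _ this
    exact ⟨A, ε, hε, fun g hg => le_of_lt (hA (j g) fun a ha => by simpa [j] using hg a ha)⟩
  · intro S ε hε
    have := ho.image_mem_nhds (nhds_Cp_mem f0 S ε hε)
    obtain ⟨B, δ, hδ, hB⟩ := mem_nhds_Cp _ _ this
    refine ⟨B, fun g hg => ?_⟩
    obtain ⟨f, hf, hfg⟩ := hB ⟨g, g.continuous⟩ (fun b hb => by simp [hf0, hg b hb, hδ])
    refine ⟨⟨fun x => f.1 x - f0.1 x, f.2.sub f0.2⟩, hf, ?_⟩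
    have : j ⟨fun x => f.1 x - f0.1 x, f.2.sub f0.2⟩ = f := by
      apply Subtype.ext; funext x; simp [j]
    ext y
    simp [this, hfg]
  · intro g
    obtain ⟨f, hfg⟩ := hs ⟨g, g.continuous⟩
    refine ⟨⟨fun x => f.1 x - f0.1 x, f.2.sub f0.2⟩, ?_⟩
    have : j ⟨fun x => f.1 x - f0.1 x, f.2.sub f0.2⟩ = f := by
      apply Subtype.ext; funext x; simp [j]
    ext y
    simp [this, hfg]

theorem sep [CompletelyRegularSpace X] (A : Finset X) (C : Set X) (hC : IsClosed C)
    (hA : ∀ a ∈ A, a ∉ C) : ∃ φ : C(X, ℝ), (∀ a ∈ A, φ a = 0) ∧ ∀ x ∈ C, φ x = 1 := by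
  have : ∀ a : A, ∃ φ : C(X, ℝ), φ a = 0 ∧ ∀ x ∈ C, φ x = 1 := by
    rintro ⟨a, ha⟩
    obtain ⟨f, hf, hf0, hf1⟩ := CompletelyRegularSpace.completely_regular a C hC (hA a ha)
    exact ⟨⟨fun x => (f x : ℝ), by fun_prop⟩, by simp [hf0], fun x hx => by simp [hf1 hx]⟩
  choose φ h0 h1 using this
  refine ⟨∏ a : A, φ a, fun a ha => ?_, fun x hx => ?_⟩
  · rw [ContinuousMap.prod_apply]
    exact Finset.prod_eq_zero (Finset.mem_univ ⟨a, ha⟩) (h0 _)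
  · rw [ContinuousMap.prod_apply]
    exact Finset.prod_eq_one fun a _ => h1 a x hx

def P (h : C(X, ℝ) → C(Y, ℝ)) (ε : ℝ) (S : Set X) (y : Y) : Prop :=
  ∀ f : C(X, ℝ), (∀ x ∈ S, |f x| < ε) → |h f y| ≤ 1

theorem P.mono {h : C(X, ℝ) → C(Y, ℝ)} {ε : ℝ} {S S' : Set X} {y : Y} (hS : S ⊆ S')
    (hP : P h ε S y) : P h ε S' y := fun f hf => hP f fun x hx => hf x (hS hx)

def T (h : C(X, ℝ) → C(Y, ℝ)) (ε : ℝ) (n : ℕ) : Set Y :=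
  {y | ∃ w : Fin n → X, P h ε (range w) y}

theorem mem_T [Nonempty X] {h : C(X, ℝ) → C(Y, ℝ)} {ε : ℝ} {n : ℕ} {S : Finset X} {y : Y}
    (hn : S.card ≤ n) (hP : P h ε S y) : y ∈ T h ε n := by
  classical
  let x0 : X := Classical.arbitrary X
  refine ⟨fun i => if hi : (i : ℕ) < S.card then (S.equivFin.symm ⟨i, hi⟩ : X) else x0, hP.mono ?_⟩
  intro x hx
  refine ⟨Fin.castLE hn (S.equivFin ⟨x, hx⟩), ?_⟩
  simp

/-- the key limiting lemma -/
theorem limit_lemma [T35Space X] {h : C(X, ℝ) → C(Y, ℝ)} (H : OkHyp h) {ε : ℝ} (hε : 0 < ε) {n : ℕ}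
    {α : Type*} (U : Ultrafilter α) (w : α → Fin n → X) (y : α → Y) (y0 : Y)
    (hP : ∀ᶠ a in U, P h ε (range (w a)) (y a)) (hy : Tendsto y U (𝓝 y0)) :
    ∃ S : Finset X, P h ε S y0 ∧ S.card ≤ n ∧ (S.card < n ∨ ∃ w0, Tendsto w U (𝓝 w0)) := by
  classical
  let I : Finset (Fin n) := Finset.univ.filter fun i => ∃ x, Tendsto (fun a => w a i) U (𝓝 x)
  have hI : ∀ i : Fin n, ∃ x, i ∈ I → Tendsto (fun a => w a i) U (𝓝 x) := by
    intro i
    by_cases hi : i ∈ I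
    · obtain ⟨x, hx⟩ := (Finset.mem_filter.1 hi).2
      exact ⟨x, fun _ => hx⟩
    · by_cases hne : Nonempty α
      · exact ⟨w hne.some i, fun h => absurd h hi⟩
      · exact absurd U.neBot.nonempty hne
  choose l hl using hI
  refine ⟨I.image l, ?_, ?_, ?_⟩
  · intro f0 hf0
    by_contra hcon
    push Not at hcon
    obtain ⟨A, hA⟩ := H.cont _ _ hcon
    -- neighbourhood
    have hN : ∀ x : X, ∃ W : Set X, IsOpen W ∧ x ∈ W ∧ ∀ i ∉ I, ∀ᶠ a in U, w a i ∉ W := by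
      intro x
      have : ∀ i : Fin n, ∃ W : Set X, IsOpen W ∧ x ∈ W ∧ (i ∉ I → ∀ᶠ a in U, w a i ∉ W) := by
        intro i
        by_cases hi : i ∈ I
        · exact ⟨univ, isOpen_univ, mem_univ _, fun h => absurd hi h⟩
        · have : ¬ Tendsto (fun a => w a i) U (𝓝 x) := fun ht =>
            hi (Finset.mem_filter.2 ⟨Finset.mem_univ _, x, ht⟩)
          rw [(nhds_basis_opens x).tendsto_right_iff] at this
          push Not at this
          obtain ⟨W, ⟨hxW, hW⟩, hn⟩ := this
          refine ⟨W, hW, hxW, fun _ => ?_⟩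
          exact hn
      choose W hW hxW hWi using this
      refine ⟨⋂ i, W i, isOpen_iInter_of_finite hW, mem_iInter.2 hxW, fun i hi => ?_⟩
      filter_upwards [hWi i hi] with a ha h
      exact ha (mem_iInter.1 h i)
    choose W hW hxW hWi using hN
    let A' := A ∪ I.image l
    obtain ⟨φ, hφ0, hφ1⟩ := sep A' (⋃ x ∈ A', W x)ᶜ
      (isOpen_biUnion fun x _ => hW x).isClosed_compl (fun a ha h => h (mem_biUnion ha (hxW a)))
    let f : C(X, ℝ) := f0 * (1 - φ)
    have h1 : 1 < |h f y0| := hA f fun a ha => by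
      simp [f, hφ0 a (Finset.mem_union_left _ ha)]
    have h2 : ∀ᶠ a in U, 1 < |h f (y a)| :=
      ((h f).continuous.abs.tendsto y0 |>.comp hy).eventually (lt_mem_nhds h1)
    have h3 : ∀ i, ∀ᶠ a in U, |f (w a i)| < ε := by
      intro i
      by_cases hi : i ∈ I
      · refine ((f.continuous.abs.tendsto (l i)).comp (hl i hi)).eventually (gt_mem_nhds ?_)
        have : l i ∈ I.image l := Finset.mem_image_of_mem _ hi
        have h4 := hφ0 _ (Finset.mem_union_right A this)
        simpa [f, h4] using hf0 (l i) (by exact_mod_cast this)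
      · have : ∀ᶠ a in U, ∀ x ∈ A', w a i ∉ W x :=
          (Filter.eventually_all_finset A').2 fun x _ => hWi x i hi
        filter_upwards [this] with a ha
        have : φ (w a i) = 1 := hφ1 _ (by simpa using ha)
        simp [f, this, hε]
    have h4 := Filter.eventually_all.2 h3
    obtain ⟨a, ha, hb, hc⟩ := (hP.and (h2.and h4)).exists
    exact absurd (ha f (by rintro _ ⟨i, rfl⟩; exact hc i)) (not_le.2 hb)
  · exact Finset.card_image_le.trans ((Finset.card_le_univ I).trans (by simp))
  · by_cases hu : I = Finset.univ
    · exact Or.inr ⟨l, tendsto_pi_nhds.2 fun i => hl i (by simp [hu])⟩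
    · left
      refine Finset.card_image_le.trans_lt ?_
      have := Finset.card_lt_univ_of_notMem (s := I) (x := Classical.choose
        (not_forall.1 fun h => hu (Finset.eq_univ_iff_forall.2 h)))
        (Classical.choose_spec (not_forall.1 fun h => hu (Finset.eq_univ_iff_forall.2 h)))
      simpa using this

theorem finite_fiber [T35Space X] [Nonempty X] {h : C(X, ℝ) → C(Y, ℝ)} (H : OkHyp h) {ε : ℝ}
    (hε : 0 < ε) {n : ℕ} (y : Y) (hy : y ∉ T h ε n) :
    {w : Fin (n + 1) → X | P h ε (range w) y}.Finite := by
  classical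
  by_contra hinf
  have hne : (Filter.cofinite ⊓ 𝓟 {w : Fin (n + 1) → X | P h ε (range w) y}).NeBot :=
    Set.Infinite.cofinite_inf_principal_neBot hinf
  let U := Ultrafilter.of (Filter.cofinite ⊓ 𝓟 {w : Fin (n + 1) → X | P h ε (range w) y})
  have hU := Ultrafilter.of_le (Filter.cofinite ⊓ 𝓟 {w : Fin (n + 1) → X | P h ε (range w) y})
  have hUc : (U : Filter (Fin (n + 1) → X)) ≤ Filter.cofinite := hU.trans inf_le_left
  have hP : ∀ᶠ w : Fin (n + 1) → X in (U : Filter (Fin (n + 1) → X)), P h ε (range w) y := Filter.le_principal_iff.1 (hU.trans inf_le_right)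
  let I : Finset (Fin (n + 1)) := Finset.univ.filter fun i => ∃ x, ∀ᶠ w : Fin (n + 1) → X in (U : Filter (Fin (n + 1) → X)), w i = x
  have hI : ∀ i : Fin (n + 1), ∃ x : X, i ∈ I → ∀ᶠ w : Fin (n + 1) → X in (U : Filter (Fin (n + 1) → X)), w i = x := by
    intro i
    by_cases hi : i ∈ I
    · obtain ⟨x, hx⟩ := (Finset.mem_filter.1 hi).2
      exact ⟨x, fun _ => hx⟩
    · exact ⟨Classical.arbitrary X, fun h => absurd h hi⟩
  choose l hl using hI
  have hIu : ∃ i, i ∉ I := by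
    by_contra hall
    push Not at hall
    have h1 : ∀ᶠ w : Fin (n + 1) → X in (U : Filter (Fin (n + 1) → X)), w = l := by
      filter_upwards [Filter.eventually_all.2 fun i => hl i (hall i)] with w hw
      exact funext hw
    have h2 : ∀ᶠ w : Fin (n + 1) → X in (U : Filter (Fin (n + 1) → X)), w ≠ l := hUc (by simp [Filter.mem_cofinite])
    obtain ⟨w, a, b⟩ := (h1.and h2).exists
    exact b a
  obtain ⟨i0, hi0⟩ := hIu
  have hcard : (I.image l).card ≤ n := by
    have := Finset.card_lt_univ_of_notMem hi0
    have h2 := Finset.card_image_le (s := I) (f := l)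
    simp at this
    omega
  have hnP : ¬ P h ε (I.image l : Finset X) y := fun hh => hy (mem_T hcard hh)
  unfold P at hnP
  push Not at hnP
  obtain ⟨f0, hf0, hcon⟩ := hnP
  obtain ⟨A, hA⟩ := H.cont _ _ hcon
  let A' := A ∪ I.image l
  have h3 : ∀ i, ∀ᶠ w : Fin (n + 1) → X in (U : Filter (Fin (n + 1) → X)), (i ∈ I → w i = l i) ∧ (i ∉ I → w i ∉ A') := by
    intro i
    by_cases hi : i ∈ I
    · filter_upwards [hl i hi] with w hw
      exact ⟨fun _ => hw, fun h => absurd hi h⟩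
    · have : ∀ᶠ w : Fin (n + 1) → X in (U : Filter (Fin (n + 1) → X)), ∀ x ∈ A', w i ≠ x := by
        refine (Filter.eventually_all_finset A').2 fun x _ => Ultrafilter.eventually_not.2 fun hx => ?_
        exact hi (Finset.mem_filter.2 ⟨Finset.mem_univ _, x, hx⟩)
      filter_upwards [this] with w hw
      exact ⟨fun h => absurd h hi, fun _ hm => hw _ hm rfl⟩
  obtain ⟨w, hw, hwi⟩ := (hP.and (Filter.eventually_all.2 h3)).exists
  obtain ⟨φ, hφ0, hφ1⟩ := sep A' (w '' {i | i ∉ I}) ((Set.toFinite _).isClosed) (by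
    rintro a ha ⟨i, hi, rfl⟩
    exact (hwi i).2 hi ha)
  have h1 : 1 < |h (f0 * (1 - φ)) y| := hA _ fun a ha => by
      simp [hφ0 a (Finset.mem_union_left _ ha)]
  refine absurd (hw (f0 * (1 - φ)) ?_) (not_le.2 h1)
  rintro _ ⟨i, rfl⟩
  by_cases hi : i ∈ I
  · rw [(hwi i).1 hi]
    have : l i ∈ I.image l := Finset.mem_image_of_mem _ hi
    have h4 := hφ0 _ (Finset.mem_union_right A this)
    simpa [h4] using hf0 (l i) (by exact_mod_cast this)
  · have : φ (w i) = 1 := hφ1 _ ⟨i, hi, rfl⟩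
    simp [this, hε]

theorem isClosed_T [T35Space X] [Nonempty X] {h : C(X, ℝ) → C(Y, ℝ)} (H : OkHyp h) {ε : ℝ}
    (hε : 0 < ε) (n : ℕ) : IsClosed (T h ε n) := by
  rw [isClosed_iff_ultrafilter]
  intro y0 U hU hT
  have : ∀ y : Y, ∃ w : Fin n → X, y ∈ T h ε n → P h ε (range w) y := by
    intro y
    by_cases hy : y ∈ T h ε n
    · obtain ⟨w, hw⟩ := hy
      exact ⟨w, fun _ => hw⟩
    · exact ⟨fun _ => Classical.arbitrary X, fun h => absurd h hy⟩
  choose w hw using this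
  obtain ⟨S, hS, hn, -⟩ := limit_lemma H hε U w id y0
    (by filter_upwards [hT] with y hy; exact hw y hy) hU
  exact mem_T hn hS

theorem isClosed_P {h : C(X, ℝ) → C(Y, ℝ)} {ε : ℝ} (n : ℕ) :
    IsClosed {z : (Fin n → X) × Y | P h ε (range z.1) z.2} := by
  have : {z : (Fin n → X) × Y | P h ε (range z.1) z.2} =
      ⋂ f : C(X, ℝ), ({z | ∀ i, |f (z.1 i)| < ε}ᶜ ∪ {z | |h f z.2| ≤ 1}) := by
    ext z
    simp only [P, mem_ofPred_eq, mem_iInter, mem_union, mem_compl_iff, forall_mem_range]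
    exact forall_congr' fun f => imp_iff_not_or
  rw [this]
  refine isClosed_iInter fun f => IsClosed.union ?_ ?_
  · rw [isClosed_compl_iff, ofPred_forall]
    refine isOpen_iInter_of_finite fun i => isOpen_lt ?_ continuous_const
    fun_prop
  · exact isClosed_le (by fun_prop) continuous_const

theorem fst_fiber [T35Space Y] {h : C(X, ℝ) → C(Y, ℝ)} (H : OkHyp h) {ε : ℝ} (hε : 0 < ε) {n : ℕ}
    (w : Fin n → X) : {y | P h ε (range w) y}.Finite := by
  classical
  obtain ⟨B, hB⟩ := H.opn (Finset.univ.image w) ε hε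
  refine B.finite_toSet.subset fun y hy => ?_
  by_contra hyB
  obtain ⟨φ, h0, h1⟩ := sep B {y} isClosed_singleton (by
    rintro a ha rfl; exact hyB ha)
  obtain ⟨f, hf, hfg⟩ := hB (φ + φ) fun b hb => by simp [h0 b hb]
  have := hy f (by rintro _ ⟨i, rfl⟩; exact hf _ (by simp))
  rw [hfg] at this
  simp [h1 y rfl] at this
  norm_num at this

theorem fst_limit [T35Space Y] {h : C(X, ℝ) → C(Y, ℝ)} (H : OkHyp h) {ε : ℝ} (hε : 0 < ε) {n : ℕ}
    {α : Type*} (U : Ultrafilter α) (w : α → Fin n → X) (y : α → Y) (w0 : Fin n → X)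
    (hP : ∀ᶠ a in U, P h ε (range (w a)) (y a)) (hw : Tendsto w U (𝓝 w0)) :
    ∃ y0, Tendsto y U (𝓝 y0) := by
  classical
  by_contra hcon
  push Not at hcon
  obtain ⟨B, hB⟩ := H.opn (Finset.univ.image w0) ε hε
  have hN : ∀ b : Y, ∃ W : Set Y, IsOpen W ∧ b ∈ W ∧ ∀ᶠ a in U, y a ∉ W := by
    intro b
    have := hcon b
    rw [(nhds_basis_opens b).tendsto_right_iff] at this
    push Not at this
    obtain ⟨W, ⟨hxW, hW⟩, hn⟩ := this
    exact ⟨W, hW, hxW, hn⟩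
  choose W hW hbW hWe using hN
  obtain ⟨φ, h0, h1⟩ := sep B (⋃ x ∈ B, W x)ᶜ
      (isOpen_biUnion fun x _ => hW x).isClosed_compl (fun a ha h => h (mem_biUnion ha (hbW a)))
  obtain ⟨f, hf, hfg⟩ := hB (φ + φ) fun b hb => by simp [h0 b hb]
  have e1 : ∀ᶠ a in U, ∀ x ∈ B, y a ∉ W x := (Filter.eventually_all_finset B).2 fun x _ => hWe x
  have e2 : ∀ᶠ a in U, ∀ i, |f (w a i)| < ε := Filter.eventually_all.2 fun i =>
    ((f.continuous.abs.tendsto (w0 i)).comp (tendsto_pi_nhds.1 hw i)).eventually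
      (gt_mem_nhds (hf _ (by simp)))
  obtain ⟨a, ha, hb, hc⟩ := (hP.and (e1.and e2)).exists
  have := ha f (by rintro _ ⟨i, rfl⟩; exact hc i)
  rw [hfg] at this
  simp [h1 (y a) (by simpa using hb)] at this
  norm_num at this

theorem piece [T35Space X] [T35Space Y] [Nonempty X] {h : C(X, ℝ) → C(Y, ℝ)} (H : OkHyp h) {ε : ℝ}
    (hε : 0 < ε) (n k : ℕ) (hnk : n + 1 ≤ k) :
    ∃ (Z : Set ((Fin k → X) × Y)) (B : Set ↥Z) (Yn : Set Y),
      Yn = T h ε (n + 1) \ T h ε n ∧ IsLocallyClosed B ∧ IsLocallyClosed Yn ∧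
      (∃ F : Set (Fin k → X), IsClosed F ∧
        ∃ p : ↥Z → ↥F, Continuous p ∧ Function.Surjective p ∧ IsClosedMap p ∧
          (∀ b, IsCompact (p ⁻¹' {b})) ∧ (∀ b, (p ⁻¹' {b}).Finite)) ∧
      (∃ r : ↥B → ↥Yn, Continuous r ∧ Function.Surjective r ∧
        IsClosedMap r ∧ (∀ b, IsCompact (r ⁻¹' {b})) ∧ (∀ b, (r ⁻¹' {b}).Finite)) := by
  let s : Fin (n + 1) → Fin k := Fin.castLE hnk
  let σ : Fin k → Fin (n + 1) := fun i => ⟨min i n, by omega⟩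
  have hσs : ∀ i, σ (s i) = i := by
    intro i; ext; simp only [σ, s, Fin.val_castLE]; omega
  let c : (Fin k → X) → (Fin (n + 1) → X) := fun x => x ∘ s
  let e : (Fin (n + 1) → X) → (Fin k → X) := fun x => x ∘ σ
  have hc : Continuous c := continuous_pi fun i => continuous_apply _
  have he : Continuous e := continuous_pi fun i => continuous_apply _
  have hce : ∀ w, c (e w) = w := fun w => by funext i; simp [c, e, hσs]
  let Z : Set ((Fin k → X) × Y) := {z | e (c z.1) = z.1 ∧ P h ε (range (c z.1)) z.2}
  let Yn : Set Y := T h ε (n + 1) \ T h ε n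
  let B : Set ↥Z := (fun z : ↥Z => z.1.2) ⁻¹' Yn
  have hZ : IsClosed Z := by
    refine IsClosed.inter (isClosed_eq (by fun_prop) (by fun_prop)) ?_
    exact (isClosed_P (h := h) (ε := ε) (n + 1)).preimage
      (f := fun z : (Fin k → X) × Y => (c z.1, z.2)) (by fun_prop)
  have hYn : IsLocallyClosed Yn :=
    (isClosed_T H hε (n + 1)).isLocallyClosed.inter (isClosed_T H hε n).isOpen_compl.isLocallyClosed
  have hsnd : Continuous (fun z : ↥Z => z.1.2) := by fun_prop
  refine ⟨Z, B, Yn, rfl, hYn.preimage hsnd, hYn, ?_, ?_⟩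
  · let q : ↥Z → (Fin k → X) := fun z => z.1.1
    have hq : IsProperMap q := by
      rw [isProperMap_iff_ultrafilter_of_t2]
      refine ⟨by fun_prop, fun U x0 hx => ?_⟩
      obtain ⟨y0, hy0⟩ := fst_limit H hε U (fun z : ↥Z => c z.1.1) (fun z => z.1.2) (c x0)
        (Filter.Eventually.of_forall fun z => z.2.2) ((hc.tendsto x0).comp hx)
      have ht : Tendsto (Subtype.val : ↥Z → _) U (𝓝 (x0, y0)) := hx.prodMk_nhds hy0
      have hm : (x0, y0) ∈ Z := hZ.mem_of_tendsto ht (Filter.Eventually.of_forall fun z => z.2)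
      exact ⟨⟨(x0, y0), hm⟩, tendsto_subtype_rng (f := id).2 ht⟩
    have hfin : ∀ x, (q ⁻¹' {x}).Finite := by
      intro x
      refine Set.Finite.of_finite_image (f := fun z : ↥Z => z.1.2)
        ((fst_fiber H hε (c x)).subset ?_) ?_
      · rintro _ ⟨z, rfl, rfl⟩
        exact z.2.2
      · intro z hz z' hz' hzz
        exact Subtype.ext (Prod.ext (hz.trans hz'.symm) hzz)
    have hfin' : ∀ b, (rangeFactorization q ⁻¹' {b}).Finite := by
      intro b
      refine (hfin b.1).subset ?_
      rintro z rfl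
      rfl
    refine ⟨range q, hq.isClosedMap.isClosed_range, rangeFactorization q,
      hq.continuous.rangeFactorization, rangeFactorization_surjective, ?_,
      fun b => (hfin' b).isCompact, hfin'⟩
    intro C hC
    have : rangeFactorization q '' C = Subtype.val ⁻¹' (q '' C) := by
      ext ⟨x, hx⟩
      simp [rangeFactorization, Subtype.ext_iff]
    rw [this]
    exact (hq.isClosedMap C hC).preimage continuous_subtype_val
  · let r : ↥B → ↥Yn := fun z => ⟨z.1.1.2, z.2⟩
    have hrc : Continuous r := by
      refine Continuous.subtype_mk ?_ _
      fun_prop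
    have hr : IsProperMap r := by
      rw [isProperMap_iff_ultrafilter_of_t2]
      refine ⟨hrc, fun U y0 hy => ?_⟩
      have hy' : Tendsto (fun z : ↥B => z.1.1.2) U (𝓝 y0.1) :=
        (continuous_subtype_val.tendsto y0).comp hy
      obtain ⟨S, hS, hSn, hlt | ⟨w0, hw0⟩⟩ := limit_lemma H hε U (fun z : ↥B => c z.1.1.1)
        (fun z => z.1.1.2) y0.1 (Filter.Eventually.of_forall fun z => z.1.2.2) hy'
      · exact absurd (mem_T (by omega) hS) y0.2.2
      · have hx : Tendsto (fun z : ↥B => z.1.1.1) U (𝓝 (e w0)) := by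
          refine ((he.tendsto w0).comp hw0).congr fun z => z.1.2.1
        have ht : Tendsto (fun z : ↥B => z.1.1) U (𝓝 (e w0, y0.1)) := hx.prodMk_nhds hy'
        have hm : (e w0, y0.1) ∈ Z :=
          hZ.mem_of_tendsto ht (Filter.Eventually.of_forall fun z => z.1.2)
        refine ⟨⟨⟨(e w0, y0.1), hm⟩, y0.2⟩, ?_⟩
        exact tendsto_subtype_rng (f := id).2 (tendsto_subtype_rng.2 ht)
    have hfin : ∀ b, (r ⁻¹' {b}).Finite := by
      intro b
      refine Set.Finite.of_finite_image (f := fun z : ↥B => c z.1.1.1)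
        ((finite_fiber H hε b.1 b.2.2).subset ?_) ?_
      · rintro _ ⟨z, rfl, rfl⟩
        exact z.1.2.2
      · intro z hz z' hz' hzz
        have h1 : z.1.1.1 = z'.1.1.1 := by
          rw [← z.1.2.1, ← z'.1.2.1]
          exact congrArg e hzz
        have h2 : z.1.1.2 = z'.1.1.2 := congrArg Subtype.val (hz.trans hz'.symm)
        exact Subtype.ext (Subtype.ext (Prod.ext h1 h2))
    refine ⟨r, hrc, ?_, hr.isClosedMap, fun b => (hfin b).isCompact, hfin⟩
    rintro ⟨y, hy⟩
    obtain ⟨w, hw⟩ := hy.1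
    exact ⟨⟨⟨(e w, y), by simp only [hce], by simpa only [hce] using hw⟩, hy⟩, rfl⟩

theorem T_cover [Nonempty X] {h : C(X, ℝ) → C(Y, ℝ)} (H : OkHyp h) (y : Y) :
    ∃ m n : ℕ, y ∈ T h (1 / ((m : ℝ) + 1)) (n + 1) \ T h (1 / ((m : ℝ) + 1)) n := by
  classical
  obtain ⟨A, ε, hε, hA⟩ := H.cont0 y
  obtain ⟨m, hm⟩ := exists_nat_one_div_lt hε
  have hex : ∃ n, y ∈ T h (1 / ((m : ℝ) + 1)) n :=
    ⟨A.card, mem_T le_rfl fun f hf => hA f fun a ha => (hf a (by exact_mod_cast ha)).trans hm⟩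
  have h0 : y ∉ T h (1 / ((m : ℝ) + 1)) 0 := by
    rintro ⟨w, hw⟩
    obtain ⟨f, hf⟩ := H.surj (ContinuousMap.const Y 2)
    have := hw f (by rintro _ ⟨i, rfl⟩; exact i.elim0)
    rw [hf] at this
    norm_num at this
  have hpos : Nat.find hex ≠ 0 := fun hz => h0 (by have := Nat.find_spec hex; rwa [hz] at this)
  obtain ⟨n, hn⟩ := Nat.exists_eq_succ_of_ne_zero hpos
  refine ⟨m, n, ?_, Nat.find_min hex (by omega)⟩
  have := Nat.find_spec hex
  rwa [hn] at this

end Okunev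

/-- Strengthened Okunev theorem: if there is a continuous open surjection from
`C_p(X)` onto `C_p(Y)` (for Tychonoff `X`, `Y`), then there are subspaces
`Z n ⊆ X^n × Y`, locally closed subspaces `B n ⊆ Z n` and locally closed subspaces
`Yn n ⊆ Y` (for `n ≥ 1`) such that each `Z n` admits a perfect finite-to-one
continuous surjection onto a closed subspace of `X^n`, each `Yn n` is the image of
`B n` under a perfect finite-to-one continuous surjection, and `Y = ⋃_{n ≥ 1} Yn n`. -/
theorem okunev_theorem_strengthened {X : Type u} {Y : Type v}
    [TopologicalSpace X] [TopologicalSpace Y] [T35Space X] [T35Space Y]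
    (hΦ : ∃ Φ : Cp X → Cp Y, Continuous Φ ∧ IsOpenMap Φ ∧ Function.Surjective Φ) :
    ∃ (Z : ∀ n : ℕ, Set ((Fin n → X) × Y))
      (B : ∀ n : ℕ, Set ↥(Z n)) (Yn : ℕ → Set Y),
      (∀ n, 1 ≤ n → IsLocallyClosed (B n)) ∧
      (∀ n, 1 ≤ n → IsLocallyClosed (Yn n)) ∧
      (∀ n, 1 ≤ n → ∃ F : Set (Fin n → X), IsClosed F ∧
        ∃ p : ↥(Z n) → ↥F, Continuous p ∧ Function.Surjective p ∧ IsClosedMap p ∧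
          (∀ b, IsCompact (p ⁻¹' {b})) ∧ (∀ b, (p ⁻¹' {b}).Finite)) ∧
      (∀ n, 1 ≤ n → ∃ r : ↥(B n) → ↥(Yn n), Continuous r ∧ Function.Surjective r ∧
        IsClosedMap r ∧ (∀ b, IsCompact (r ⁻¹' {b})) ∧ (∀ b, (r ⁻¹' {b}).Finite)) ∧
      (⋃ n, ⋃ (_ : 1 ≤ n), Yn n) = Set.univ := by
  obtain ⟨h, H⟩ := Okunev.exists_okHyp hΦ
  rcases isEmpty_or_nonempty X with hX | hX
  · have hY : IsEmpty Y := by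
      by_contra hY
      rw [not_isEmpty_iff] at hY
      obtain ⟨f, hf⟩ := H.surj 0
      obtain ⟨g, hg⟩ := H.surj 1
      have : f = g := by ext x; exact isEmptyElim x
      rw [← this, hf] at hg
      have := congrArg (fun u : C(Y, ℝ) => u hY.some) hg
      simp at this
    refine ⟨fun _ => ∅, fun _ => ∅, fun _ => ∅, fun _ _ => isClosed_empty.isLocallyClosed,
      fun _ _ => isClosed_empty.isLocallyClosed, fun n _ => ⟨∅, isClosed_empty, ?_⟩,
      fun n _ => ?_, Subsingleton.elim _ _⟩
    · exact ⟨fun z => z.2.elim, continuous_of_const fun z => z.2.elim, fun z => z.2.elim,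
        fun _ _ => by rw [Set.eq_empty_of_isEmpty (_ '' _)]; exact isClosed_empty,
        fun z => z.2.elim, fun z => z.2.elim⟩
    · exact ⟨fun z => z.2.elim, continuous_of_const fun z => z.2.elim, fun z => z.2.elim,
        fun _ _ => by rw [Set.eq_empty_of_isEmpty (_ '' _)]; exact isClosed_empty,
        fun z => z.2.elim, fun z => z.2.elim⟩
  · have key : ∀ k : ℕ, ∃ (Z : Set ((Fin k → X) × Y)) (B : Set ↥Z) (Yn : Set Y), 1 ≤ k →
        (Yn = Okunev.T h (1 / (((k - 1).unpair.1 : ℝ) + 1)) ((k - 1).unpair.2 + 1) \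
          Okunev.T h (1 / (((k - 1).unpair.1 : ℝ) + 1)) (k - 1).unpair.2 ∧
        IsLocallyClosed B ∧ IsLocallyClosed Yn ∧
        (∃ F : Set (Fin k → X), IsClosed F ∧
          ∃ p : ↥Z → ↥F, Continuous p ∧ Function.Surjective p ∧ IsClosedMap p ∧
            (∀ b, IsCompact (p ⁻¹' {b})) ∧ (∀ b, (p ⁻¹' {b}).Finite)) ∧
        (∃ r : ↥B → ↥Yn, Continuous r ∧ Function.Surjective r ∧
          IsClosedMap r ∧ (∀ b, IsCompact (r ⁻¹' {b})) ∧ (∀ b, (r ⁻¹' {b}).Finite))) := by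
      intro k
      by_cases hk : 1 ≤ k
      · have := Nat.unpair_right_le (k - 1)
        obtain ⟨Z, B, Yn, hh⟩ := Okunev.piece H
          (ε := 1 / (((k - 1).unpair.1 : ℝ) + 1)) (by positivity) (k - 1).unpair.2 k (by omega)
        exact ⟨Z, B, Yn, fun _ => hh⟩
      · exact ⟨∅, ∅, ∅, fun h => absurd h hk⟩
    choose Z B Yn hh using key
    refine ⟨Z, B, Yn, fun n hn => (hh n hn).2.1, fun n hn => (hh n hn).2.2.1,
      fun n hn => (hh n hn).2.2.2.1, fun n hn => (hh n hn).2.2.2.2, ?_⟩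
    refine Set.eq_univ_of_forall fun y => ?_
    obtain ⟨m, n, hmn⟩ := Okunev.T_cover H y
    refine Set.mem_iUnion₂.2 ⟨Nat.pair m n + 1, by omega, ?_⟩
    rw [(hh (Nat.pair m n + 1) (by omega)).1]
    simpa using hmn
end

section
/- Let X and Y be σ-compact metrizable spaces such that C_p(Y) is the image of C_p(X) under a continuous open mapping, and fix an integer k ≥ 2. If for every integer n ≥ 1 the finite power X^n is a k-C-space, then Y is a k-C-space. -/
/-- A topological space `Z` is a `k`-`C`-space if for every sequence `U i` of open covers
of `Z`, each consisting of at most `k` open sets, there is a sequence `V i` of families of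
pairwise disjoint open sets such that each member of `V i` is contained in some member of
`U i` and `⋃ i, V i` covers `Z`. -/
def IsKCSpace (k : ℕ) (Z : Type*) [TopologicalSpace Z] : Prop :=
  ∀ U : ℕ → Set (Set Z),
    (∀ i, (∀ s ∈ U i, IsOpen s) ∧ ⋃₀ U i = Set.univ ∧ (U i).Finite ∧ (U i).ncard ≤ k) →
    ∃ V : ℕ → Set (Set Z),
      (∀ i, (∀ s ∈ V i, IsOpen s) ∧ (V i).PairwiseDisjoint id ∧
        ∀ s ∈ V i, ∃ t ∈ U i, s ⊆ t) ∧
      ⋃₀ (⋃ i, V i) = Set.univ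

def KCS (k : ℕ) {Z : Type*} [TopologicalSpace Z] (S : Set Z) : Prop :=
  ∀ U : ℕ → Fin k → Set Z, (∀ i a, IsOpen (U i a)) → (∀ i z, ∃ a, z ∈ U i a) →
    ∃ V : ℕ → Fin k → Set Z, (∀ i a, IsOpen (V i a)) ∧ (∀ i a, V i a ⊆ U i a) ∧
      (∀ i a b, a ≠ b → Disjoint (V i a) (V i b)) ∧ ∀ z ∈ S, ∃ i a, z ∈ V i a

theorem IsKCSpace.kcs {k : ℕ} {Z : Type*} [TopologicalSpace Z] (h : IsKCSpace k Z) :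
    KCS k (Set.univ : Set Z) := by
  intro U hU hc
  obtain ⟨V, hV, hcov⟩ := h (fun i => Set.range (U i)) (by
    intro i
    refine ⟨?_, ?_, Set.finite_range _, ?_⟩
    · rintro s ⟨a, rfl⟩; exact hU i a
    · ext z
      simp only [Set.sUnion_range, Set.mem_iUnion, Set.mem_univ, iff_true]
      exact hc i z
    · rw [← Set.image_univ]
      refine (Set.ncard_image_le Set.finite_univ).trans ?_
      simp [Set.ncard_univ])
  refine ⟨fun i a => ⋃₀ {s | ∃ hs : s ∈ V i, ∃ h2 : s ⊆ U i a,
      ∀ b, s ⊆ U i b → a ≤ b}, ?_, ?_, ?_, ?_⟩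
  · intro i a
    apply isOpen_sUnion
    rintro s ⟨hs, -⟩
    exact (hV i).1 s hs
  · intro i a
    apply Set.sUnion_subset
    rintro s ⟨hs, h2, -⟩
    exact h2
  · intro i a b hab
    rw [Set.disjoint_left]
    rintro z ⟨s, ⟨hs, h2, h3⟩, hz⟩ ⟨t, ⟨ht, h4, h5⟩, hz'⟩
    by_cases hst : s = t
    · subst hst
      exact hab (le_antisymm (h3 b h4) (h5 a h2))
    · exact Set.disjoint_left.1 ((hV i).2.1 hs ht hst) hz hz'
  · intro z _
    have hz : z ∈ ⋃₀ (⋃ i, V i) := by rw [hcov]; trivial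
    obtain ⟨s, hs, hz⟩ := hz
    obtain ⟨i, hs⟩ := Set.mem_iUnion.1 hs
    obtain ⟨t, ⟨a, rfl⟩, hst⟩ := (hV i).2.2 s hs
    classical
    obtain ⟨a0, ha0, hmin⟩ := Finset.exists_min_image
      (Finset.univ.filter (fun a => s ⊆ U i a)) id ⟨a, by simpa using hst⟩
    refine ⟨i, a0, s, ⟨hs, by simpa using ha0, fun b hb => hmin b (by simpa using hb)⟩, hz⟩

theorem KCS.isKCSpace {k : ℕ} {Z : Type*} [TopologicalSpace Z]
    (h : KCS k (Set.univ : Set Z)) : IsKCSpace k Z := by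
  intro U hU
  have key : ∀ i, ∃ u : Fin k → Set Z, (∀ a, u a ∈ U i ∨ u a = ∅) ∧
      ∀ s ∈ U i, ∃ a, u a = s := by
    intro i
    obtain ⟨-, -, hf, hn⟩ := hU i
    classical
    have : hf.toFinset.card ≤ k := by rwa [← Set.ncard_eq_toFinset_card _ hf]
    let e := hf.toFinset.equivFin
    refine ⟨fun a => if ha : a.1 < hf.toFinset.card then (e.symm ⟨a, ha⟩).1 else ∅, ?_, ?_⟩
    · intro a
      by_cases ha : a.1 < hf.toFinset.card
      · left; simp only [ha, dif_pos]
        exact hf.mem_toFinset.1 (e.symm ⟨a, ha⟩).2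
      · right; simp [ha]
    · intro s hs
      let w := e ⟨s, hf.mem_toFinset.2 hs⟩
      refine ⟨⟨w.1, lt_of_lt_of_le w.2 this⟩, ?_⟩
      have hw : w.1 < hf.toFinset.card := w.2
      simp only [hw, dif_pos]
      simp [w]
  choose u hu hu' using key
  obtain ⟨V, hV, hVU, hd, hcov⟩ := h u (by
    intro i a
    rcases hu i a with h | h
    · exact (hU i).1 _ h
    · rw [h]; exact isOpen_empty) (by
    intro i z
    have hz : z ∈ ⋃₀ U i := by rw [(hU i).2.1]; trivial
    obtain ⟨s, hs, hz⟩ := hz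
    obtain ⟨a, rfl⟩ := hu' i s hs
    exact ⟨a, hz⟩)
  refine ⟨fun i => {s | ∃ a, s = V i a ∧ u i a ∈ U i}, ?_, ?_⟩
  · intro i
    refine ⟨?_, ?_, ?_⟩
    · rintro s ⟨a, rfl, -⟩; exact hV i a
    · rintro s ⟨a, rfl, -⟩ t ⟨b, rfl, -⟩ hne
      exact hd i a b (fun h => hne (by rw [h]))
    · rintro s ⟨a, rfl, ha⟩
      exact ⟨_, ha, hVU i a⟩
  · ext z
    simp only [Set.mem_univ, iff_true]
    obtain ⟨i, a, hz⟩ := hcov z trivial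
    refine ⟨V i a, Set.mem_iUnion.2 ⟨i, a, rfl, ?_⟩, hz⟩
    rcases hu i a with h | h
    · exact h
    · have := hVU i a hz
      rw [h] at this; exact this.elim

theorem KCS.mono {k : ℕ} {Z : Type*} [TopologicalSpace Z] {S T : Set Z}
    (h : KCS k S) (hT : T ⊆ S) : KCS k T := by
  intro U h1 h2
  obtain ⟨V, a, b, c, d⟩ := h U h1 h2
  exact ⟨V, a, b, c, fun z hz => d z (hT hz)⟩

theorem KCS.iUnionNat {k : ℕ} {Z : Type*} [TopologicalSpace Z] {S : ℕ → Set Z}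
    (h : ∀ j, KCS k (S j)) : KCS k (⋃ j, S j) := by
  intro U h1 h2
  choose V a b c d using fun j => h j (fun i => U (Nat.pair j i)) (fun i => h1 _) (fun i => h2 _)
  refine ⟨fun n => V n.unpair.1 n.unpair.2, fun i => a _ _, ?_, fun i => c _ _, ?_⟩
  · intro i x
    have := b i.unpair.1 i.unpair.2 x
    rwa [Nat.pair_unpair] at this
  · intro z hz
    obtain ⟨j, hz⟩ := Set.mem_iUnion.1 hz
    obtain ⟨i, x, hx⟩ := d j z hz
    exact ⟨Nat.pair j i, x, by simpa using hx⟩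

theorem KCS.empty {k : ℕ} {Z : Type*} [TopologicalSpace Z] : KCS k (∅ : Set Z) :=
  fun _ _ _ => ⟨fun _ _ => ∅, fun _ _ => isOpen_empty, fun _ _ => Set.empty_subset _,
    fun _ _ _ _ => disjoint_bot_left, fun _ hz => hz.elim⟩

theorem KCS.iUnion {k : ℕ} {Z ι : Type*} [TopologicalSpace Z] [Countable ι] {S : ι → Set Z}
    (h : ∀ j, KCS k (S j)) : KCS k (⋃ j, S j) := by
  rcases isEmpty_or_nonempty ι with hι | hι
  · rw [Set.iUnion_of_empty]; exact KCS.empty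
  · obtain ⟨f, hf⟩ := exists_surjective_nat ι
    rw [← hf.iUnion_comp]
    exact KCS.iUnionNat (fun j => h (f j))

theorem KCS.split {k : ℕ} {Z : Type*} [TopologicalSpace Z] {S S' : Set Z}
    (h : KCS k S') (h' : ∀ W, IsOpen W → S' ⊆ W → KCS k (S \ W)) : KCS k S := by
  intro U h1 h2
  obtain ⟨V, a, b, c, d⟩ := h (fun i => U (2 * i)) (fun i => h1 _) (fun i => h2 _)
  obtain ⟨V', a', b', c', d'⟩ := h' (⋃ i, ⋃ x, V i x)
    (isOpen_iUnion fun i => isOpen_iUnion fun x => a i x)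
    (fun z hz => by simpa using d z hz)
    (fun i => U (2 * i + 1)) (fun i => h1 _) (fun i => h2 _)
  refine ⟨fun n => if n % 2 = 0 then V (n / 2) else V' (n / 2), ?_, ?_, ?_, ?_⟩
  · intro i; dsimp only; split_ifs
    · exact a _
    · exact a' _
  · intro i; dsimp only; split_ifs with hi
    · have := b (i / 2)
      rwa [show 2 * (i / 2) = i by omega] at this
    · have := b' (i / 2)
      rwa [show 2 * (i / 2) + 1 = i by omega] at this
  · intro i; dsimp only; split_ifs
    · exact c _
    · exact c' _
  · intro z hz
    by_cases hw : z ∈ ⋃ i, ⋃ x, V i x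
    · simp only [Set.mem_iUnion] at hw
      obtain ⟨i, x, hx⟩ := hw
      refine ⟨2 * i, x, ?_⟩
      simpa using hx
    · obtain ⟨i, x, hx⟩ := d' z ⟨hz, hw⟩
      refine ⟨2 * i + 1, x, ?_⟩
      have e1 : (2 * i + 1) % 2 = 1 := by omega
      have e2 : (2 * i + 1) / 2 = i := by omega
      simpa [e1, e2] using hx

theorem KCS.of_injOn {k : ℕ} (hk : 2 ≤ k) {Z W : Type*} [TopologicalSpace Z] [TopologicalSpace W]
    [T2Space W] {p : Z → W} (hp : Continuous p) {R : Set Z} (hR : IsCompact R)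
    (hinj : Set.InjOn p R) (hW : KCS k (Set.univ : Set W)) : KCS k R := by
  intro U h1 h2
  obtain ⟨V, a, b, c, d⟩ := hW (fun i x => (p '' (R \ U i x))ᶜ)
    (fun i x => ((hR.diff (h1 i x)).image hp).isClosed.isOpen_compl) (by
      intro i w
      by_cases hw : w ∈ p '' R
      · obtain ⟨r, hr, rfl⟩ := hw
        obtain ⟨x, hx⟩ := h2 i r
        refine ⟨x, ?_⟩
        rintro ⟨r', ⟨hr', hx'⟩, he⟩
        rw [hinj hr' hr he] at hx'
        exact hx' hx
      · refine ⟨⟨0, by omega⟩, ?_⟩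
        rintro ⟨r', ⟨hr', hx'⟩, he⟩
        exact hw ⟨r', hr', he⟩)
  refine ⟨fun i x => p ⁻¹' V i x ∩ U i x, fun i x => ((a i x).preimage hp).inter (h1 i x),
    fun i x => Set.inter_subset_right, ?_, ?_⟩
  · intro i x y hxy
    exact ((c i x y hxy).preimage p).mono Set.inter_subset_left Set.inter_subset_left
  · intro z hz
    obtain ⟨i, x, hx⟩ := d (p z) trivial
    refine ⟨i, x, hx, ?_⟩
    by_contra hn
    exact b i x hx ⟨z, ⟨hz, hn⟩, rfl⟩

/-- points of `p '' L` with `j` points in the fibre that are `1/(l+1)`-separated -/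
def sepF {Z W : Type*} [MetricSpace Z] (p : Z → W) (L : Set Z) (j l : ℕ) : Set W :=
  {w | w ∈ p '' L ∧ ∃ e : Fin j → Z, (∀ i, e i ∈ L ∧ p (e i) = w) ∧
    ∀ i i', i ≠ i' → 1 / ((l : ℝ) + 1) ≤ dist (e i) (e i')}

theorem sepF_closed {Z W : Type*} [MetricSpace Z] [TopologicalSpace W] [T2Space W]
    {p : Z → W} (hp : Continuous p) {L : Set Z} (hL : IsCompact L) (j l : ℕ) :
    IsClosed (sepF p L j l) := by
  have hK : IsCompact ((Set.univ.pi fun _ : Fin j => L) ×ˢ (p '' L)) :=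
    (isCompact_univ_pi fun _ => hL).prod (hL.image hp)
  have hC : IsClosed {q : (Fin j → Z) × W | (∀ i, p (q.1 i) = q.2) ∧
      ∀ i i', i ≠ i' → 1 / ((l : ℝ) + 1) ≤ dist (q.1 i) (q.1 i')} := by
    simp only [Set.setOf_and, Set.setOf_forall]
    refine IsClosed.inter (isClosed_iInter fun i => ?_)
      (isClosed_iInter fun i => isClosed_iInter fun i' => isClosed_iInter fun _ => ?_)
    · exact isClosed_eq (by fun_prop) (by fun_prop)
    · exact isClosed_le (by fun_prop) (by fun_prop)
  have := ((hK.inter_right hC).image continuous_snd).isClosed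
  convert this using 1
  ext w
  constructor
  · rintro ⟨hw, e, he, hd⟩
    exact ⟨(e, w), ⟨⟨fun i _ => (he i).1, hw⟩, fun i => (he i).2, hd⟩, rfl⟩
  · rintro ⟨⟨e, w'⟩, ⟨⟨h1, h2⟩, h3, h4⟩, rfl⟩
    exact ⟨h2, e, fun i => ⟨h1 i trivial, h3 i⟩, h4⟩

theorem mem_sepF_of_inj {Z W : Type*} [MetricSpace Z] {p : Z → W} {L : Set Z} {j : ℕ} {w : W}
    (hw : w ∈ p '' L) (e : Fin j → Z) (he : ∀ i, e i ∈ L ∧ p (e i) = w)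
    (hinj : Function.Injective e) : ∃ l, w ∈ sepF p L j l := by
  classical
  have : ∀ q : Fin j × Fin j, ∃ l : ℕ, q.1 ≠ q.2 → 1 / ((l : ℝ) + 1) ≤ dist (e q.1) (e q.2) := by
    intro q
    by_cases h : q.1 = q.2
    · exact ⟨0, fun h' => (h' h).elim⟩
    · obtain ⟨l, hl⟩ := exists_nat_one_div_lt (dist_pos.2 (hinj.ne h))
      exact ⟨l, fun _ => hl.le⟩
  choose l hl using this
  refine ⟨Finset.univ.sup l, hw, e, he, fun i i' hne => le_trans ?_ (hl (i, i') hne)⟩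
  apply one_div_le_one_div_of_le (by positivity)
  have : l (i, i') ≤ Finset.univ.sup l := Finset.le_sup (Finset.mem_univ _)
  have : (l (i, i') : ℝ) ≤ (Finset.univ.sup l : ℕ) := by exact_mod_cast this
  linarith

theorem kcs_step {k : ℕ} (hk : 2 ≤ k) {Z W : Type*} [MetricSpace Z]
    [SecondCountableTopology Z] [TopologicalSpace W] [T2Space W]
    {p : Z → W} (hp : Continuous p) {L : Set Z} (hL : IsCompact L)
    (hW : KCS k (Set.univ : Set W)) {T : Set W} (hT : IsClosed T) {j l : ℕ}
    (hTF : T ⊆ sepF p L j l)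
    (hn : ∀ l', KCS k (L ∩ p ⁻¹' (T ∩ sepF p L (j + 1) l'))) : KCS k (L ∩ p ⁻¹' T) := by
  refine KCS.split (KCS.iUnionNat hn) ?_
  intro O hO hsub
  set R := (L ∩ p ⁻¹' T) \ O with hRdef
  have hR : IsCompact R := (hL.inter_right (hT.preimage hp)).diff hO
  rcases isEmpty_or_nonempty Z with hZ | hZ
  · have : R = ∅ := Set.eq_empty_of_isEmpty _
    rw [this]; exact KCS.empty
  have hδ : (0 : ℝ) < 1 / ((l : ℝ) + 1) := by positivity
  set δ := 1 / ((l : ℝ) + 1)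
  have hfin : ∀ e ∈ R, ∀ e' ∈ R, p e = p e' → dist e e' < δ → e = e' := by
    intro e he e' he' hpe hd
    obtain ⟨hw, c, hc, hsep⟩ := hTF he.1.2
    have hcinj : Function.Injective c := by
      intro i i' hii
      by_contra hne
      have := hsep i i' hne
      rw [hii, dist_self] at this
      exact absurd hδ (not_lt.2 this)
    have hall : ∀ x ∈ R, p x = p e → ∃ i, c i = x := by
      intro x hx hpx
      by_contra hno
      push Not at hno
      obtain ⟨l', hl'⟩ := mem_sepF_of_inj (p := p) (L := L) (j := j + 1) hw (Fin.cons x c) (by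
        intro i
        refine Fin.cases ?_ ?_ i
        · simpa using ⟨hx.1.1, hpx⟩
        · intro i; simpa using hc i) (by
        rw [Fin.cons_injective_iff]
        exact ⟨fun ⟨i, hi⟩ => hno i hi, hcinj⟩)
      apply hx.2
      apply hsub
      refine Set.mem_iUnion.2 ⟨l', hx.1.1, hx.1.2, ?_⟩
      rw [hpx]; exact hl'
    obtain ⟨i, rfl⟩ := hall e he rfl
    obtain ⟨i', rfl⟩ := hall e' he' hpe.symm
    by_contra hne
    exact absurd hd (not_lt.2 (hsep i i' (fun h => hne (by rw [h]))))
  have : R ⊆ ⋃ t, R ∩ Metric.closedBall (TopologicalSpace.denseSeq Z t) (δ / 3) := by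
    intro z hz
    obtain ⟨t, ht⟩ := (TopologicalSpace.denseRange_denseSeq Z).exists_dist_lt z
      (show 0 < δ / 3 by positivity)
    exact Set.mem_iUnion.2 ⟨t, hz, Metric.mem_closedBall.2 ht.le⟩
  refine KCS.mono (KCS.iUnionNat fun t => ?_) this
  refine KCS.of_injOn hk hp (hR.inter_right Metric.isClosed_closedBall) ?_ hW
  rintro e ⟨he, hb⟩ e' ⟨he', hb'⟩ hpe
  refine hfin e he e' he' hpe ?_
  have := dist_triangle_right e e' (TopologicalSpace.denseSeq Z t)
  rw [Metric.mem_closedBall] at hb hb'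
  linarith

theorem kcs_finite_to_one {k : ℕ} (hk : 2 ≤ k) {Z W : Type*} [MetricSpace Z]
    [SecondCountableTopology Z] [TopologicalSpace W] [T2Space W]
    {p : Z → W} (hp : Continuous p) {L : Set Z} (hL : IsCompact L)
    (hW : KCS k (Set.univ : Set W)) (hfin : ∀ w, (L ∩ p ⁻¹' {w}).Finite) : KCS k L := by
  by_contra hbad
  let P : ℕ → Type _ := fun j => {T : Set W // IsClosed T ∧ (∃ l, T ⊆ sepF p L j l) ∧
    ¬ KCS k (L ∩ p ⁻¹' T)}
  have hstep : ∀ j (T : P j), ∃ T' : P (j + 1), T'.1 ⊆ T.1 := by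
    rintro j ⟨T, hT, ⟨l, hTl⟩, hb⟩
    have : ∃ l', ¬ KCS k (L ∩ p ⁻¹' (T ∩ sepF p L (j + 1) l')) := by
      by_contra hno
      push Not at hno
      exact hb (kcs_step hk hp hL hW hT hTl hno)
    obtain ⟨l', hl'⟩ := this
    exact ⟨⟨_, hT.inter (sepF_closed hp hL _ _), ⟨l', Set.inter_subset_right⟩, hl'⟩,
      Set.inter_subset_left⟩
  choose nx hnx using hstep
  let T0 : P 0 := ⟨p '' L, (hL.image hp).isClosed, ⟨0, fun w hw => ⟨hw, Fin.elim0,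
    fun i => i.elim0, fun i => i.elim0⟩⟩, by
      rwa [Set.inter_eq_left.2 (Set.subset_preimage_image p L)]⟩
  let T : ∀ j, P j := fun j => Nat.rec T0 (fun j t => nx j t) j
  have hdec : ∀ j, (T (j + 1)).1 ⊆ (T j).1 := fun j => hnx j (T j)
  have hne : ∀ j, (T j).1.Nonempty := by
    intro j
    by_contra h
    rw [Set.not_nonempty_iff_eq_empty] at h
    apply (T j).2.2.2
    rw [h, Set.preimage_empty, Set.inter_empty]
    exact KCS.empty
  obtain ⟨w, hw⟩ := IsCompact.nonempty_iInter_of_sequence_nonempty_isCompact_isClosed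
    (fun j => (T j).1) hdec hne (hL.image hp) (fun j => (T j).2.1)
  rw [Set.mem_iInter] at hw
  set n := (hfin w).toFinset.card with hn
  obtain ⟨l, hl⟩ := (T (n + 1)).2.2.1
  obtain ⟨-, e, he, hsep⟩ := hl (hw (n + 1))
  have hinj : Function.Injective e := by
    intro i i' hii
    by_contra hne
    have := hsep i i' hne
    rw [hii, dist_self] at this
    have h0 : (0 : ℝ) < 1 / ((l : ℝ) + 1) := by positivity
    linarith
  have := Finset.card_le_card_of_injOn (s := (Finset.univ : Finset (Fin (n + 1))))
    (t := (hfin w).toFinset) e (fun i _ => by simpa using he i) hinj.injOn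
  simp at this
  omega

theorem kcs_singleton_fibres {k : ℕ} {Z Y : Type*} [TopologicalSpace Z] [MetricSpace Y]
    {q : Z → Y} (hq : Continuous q) {L : Set Z} (hL : IsCompact L) (hk : KCS k L) :
    KCS k {y | ∃ e ∈ L, q e = y ∧ ∀ e' ∈ L, q e' = y → e' = e} := by
  intro U h1 h2
  obtain ⟨W, a, b, c, d⟩ := hk (fun i x => q ⁻¹' U i x) (fun i x => (h1 i x).preimage hq)
    (fun i z => h2 i (q z))
  let C : ℕ → Fin k → Set Y := fun i x => q '' (L \ W i x)
  let A : ℕ → Fin k → Set Y := fun i x => q '' L \ C i x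
  have hC : ∀ i x, IsClosed (C i x) := fun i x => ((hL.diff (a i x)).image hq).isClosed
  have hAC : ∀ i x y, x ≠ y → A i y ⊆ C i x := by
    rintro i x y hxy _ ⟨⟨e, he, rfl⟩, hn⟩
    refine ⟨e, ⟨he, fun hx => ?_⟩, rfl⟩
    have hy : e ∈ W i y := by
      by_contra h; exact hn ⟨e, ⟨he, h⟩, rfl⟩
    exact Set.disjoint_left.1 (c i x y hxy) hx hy
  refine ⟨fun i x => {y | Metric.infEDist y (A i x) < Metric.infEDist y (C i x)} ∩ U i x,
    ?_, fun i x => Set.inter_subset_right, ?_, ?_⟩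
  · intro i x
    exact (isOpen_lt Metric.continuous_infEDist Metric.continuous_infEDist).inter (h1 i x)
  · intro i x y hxy
    rw [Set.disjoint_left]
    rintro z ⟨hz, -⟩ ⟨hz', -⟩
    simp only [Set.mem_setOf_eq] at hz hz'
    have e1 := Metric.infEDist_anti (x := z) (hAC i x y hxy)
    have e2 := Metric.infEDist_anti (x := z) (hAC i y x hxy.symm)
    exact absurd (hz.trans_le (e1.trans (hz'.le.trans e2))) (lt_irrefl _)
  · rintro _ ⟨e, he, rfl, hu⟩
    obtain ⟨i, x, hx⟩ := d e he
    refine ⟨i, x, ?_, b i x hx⟩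
    have hnC : q e ∉ C i x := by
      rintro ⟨e', ⟨he', hn⟩, hee⟩
      rw [hu e' he' hee] at hn
      exact hn hx
    have hA : q e ∈ A i x := ⟨⟨e, he, rfl⟩, hnC⟩
    simp only [Set.mem_setOf_eq]
    rw [Metric.infEDist_zero_of_mem hA, pos_iff_ne_zero]
    intro h0
    apply hnC
    rw [← (hC i x).closure_eq, Metric.mem_closure_iff_infEDist_zero]
    exact h0

theorem Cp_nhds {X : Type*} [TopologicalSpace X] {O : Set (Cp X)} (hO : IsOpen O) {f : Cp X}
    (hf : f ∈ O) : ∃ (B : Finset X) (m : ℕ), ∀ f' : Cp X,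
      (∀ b ∈ B, |f'.1 b - f.1 b| < 1 / ((m : ℝ) + 1)) → f' ∈ O := by
  classical
  obtain ⟨O', hO', rfl⟩ := isOpen_induced_iff.1 hO
  obtain ⟨I, u, hu, hsub⟩ := isOpen_pi_iff.1 hO' f.1 hf
  have : ∀ b : X, ∃ m : ℕ, b ∈ I → ∀ r : ℝ, |r - f.1 b| < 1 / ((m : ℝ) + 1) → r ∈ u b := by
    intro b
    by_cases hb : b ∈ I
    · obtain ⟨ε, hε, h⟩ := Metric.isOpen_iff.1 (hu b hb).1 _ (hu b hb).2
      obtain ⟨m, hm⟩ := exists_nat_one_div_lt hε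
      refine ⟨m, fun _ r hr => h ?_⟩
      rw [Metric.mem_ball, Real.dist_eq]
      exact hr.trans hm
    · exact ⟨0, fun h => (hb h).elim⟩
  choose m hm using this
  refine ⟨I, I.sup m, fun f' hf' => hsub ?_⟩
  intro b hb
  refine hm b hb _ ((hf' b hb).trans_le ?_)
  apply one_div_le_one_div_of_le (by positivity)
  have : m b ≤ I.sup m := Finset.le_sup hb
  have : (m b : ℝ) ≤ (I.sup m : ℕ) := by exact_mod_cast this
  linarith

theorem Cp_eval_continuous {X : Type*} [TopologicalSpace X] (x : X) :
    Continuous (fun f : Cp X => f.1 x) :=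
  (continuous_apply x).comp continuous_subtype_val

theorem exists_interp {X : Type*} [TopologicalSpace X] [NormalSpace X] [T1Space X]
    (f g : Cp X) {S T : Set X} (hS : S.Finite) (hT : T.Finite) (hd : Disjoint S T) :
    ∃ h : Cp X, (∀ x ∈ S, h.1 x = f.1 x) ∧ ∀ x ∈ T, h.1 x = g.1 x := by
  obtain ⟨u, h0, h1, -⟩ := exists_continuous_zero_one_of_isClosed hS.isClosed hT.isClosed hd
  have hf := f.2
  have hg := g.2
  refine ⟨⟨fun x => (1 - u x) * f.1 x + u x * g.1 x, by fun_prop⟩, ?_, ?_⟩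
  · intro x hx
    have := h0 hx
    simp only [Pi.zero_apply] at this
    simp [this]
  · intro x hx
    have := h1 hx
    simp only [Pi.one_apply] at this
    simp [this]

/-- the set `E` -/
def EE {X Y : Type*} [TopologicalSpace X] [TopologicalSpace Y] (Φ : Cp X → Cp Y) (f0 : Cp X)
    (n m : ℕ) : Set ((Fin n → X) × Y) :=
  {z | ∀ f : Cp X, (∀ i, |f.1 (z.1 i) - f0.1 (z.1 i)| < 1 / ((m : ℝ) + 1)) → |(Φ f).1 z.2| ≤ 1}

theorem EE_closed {X Y : Type*} [TopologicalSpace X] [TopologicalSpace Y] (Φ : Cp X → Cp Y)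
    (f0 : Cp X) (n m : ℕ) : IsClosed (EE Φ f0 n m) := by
  have : (EE Φ f0 n m)ᶜ = ⋃ f : Cp X, {z | (∀ i, |f.1 (z.1 i) - f0.1 (z.1 i)| < 1 / ((m : ℝ) + 1))
      ∧ 1 < |(Φ f).1 z.2|} := by
    ext z
    simp [EE]
  rw [← isOpen_compl_iff, this]
  refine isOpen_iUnion fun f => ?_
  have h1 := f.2
  have h2 := f0.2
  have h3 := (Φ f).2
  rw [Set.setOf_and, Set.setOf_forall]
  refine IsOpen.inter (isOpen_iInter_of_finite fun i => isOpen_lt (by fun_prop) (by fun_prop))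
    (isOpen_lt (by fun_prop) (by fun_prop))

theorem EE_finite {X Y : Type*} [TopologicalSpace X] [TopologicalSpace Y]
    [NormalSpace Y] [T1Space Y] {Φ : Cp X → Cp Y} (hΦ : IsOpenMap Φ)
    {f0 : Cp X} (h0 : ∀ y, (Φ f0).1 y = 0) (n m : ℕ) (x : Fin n → X) :
    {z | z ∈ EE Φ f0 n m ∧ z.1 = x}.Finite := by
  have hN : IsOpen {f : Cp X | ∀ i, |f.1 (x i) - f0.1 (x i)| < 1 / ((m : ℝ) + 1)} := by
    rw [Set.setOf_forall]
    refine isOpen_iInter_of_finite fun i => isOpen_lt ?_ continuous_const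
    exact ((Cp_eval_continuous (x i)).sub continuous_const).abs
  have hf0 : f0 ∈ {f : Cp X | ∀ i, |f.1 (x i) - f0.1 (x i)| < 1 / ((m : ℝ) + 1)} := by
    intro i; simp; positivity
  obtain ⟨B, r, hB⟩ := Cp_nhds (hΦ _ hN) (Set.mem_image_of_mem Φ hf0)
  refine ((B.finite_toSet).image (fun y => (x, y))).subset ?_
  rintro ⟨x', y⟩ ⟨hz, rfl⟩
  refine ⟨y, ?_, rfl⟩
  by_contra hy
  obtain ⟨g, hg, hg'⟩ := exists_interp (⟨fun _ => 0, continuous_const⟩ : Cp Y)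
    ⟨fun _ => 2, continuous_const⟩ B.finite_toSet (Set.finite_singleton y)
    (Set.disjoint_singleton_right.2 hy)
  obtain ⟨f, hf, rfl⟩ := hB g (by
    intro b hb
    rw [hg b hb, h0]; simp; positivity)
  have := hz f hf
  simp only at this
  rw [hg' y rfl] at this
  norm_num at this

theorem EE_isolated {X Y : Type*} [TopologicalSpace X] [TopologicalSpace Y]
    [NormalSpace X] [T1Space X] {Φ : Cp X → Cp Y} (hc : Continuous Φ)
    (hs : Function.Surjective Φ)
    {f0 : Cp X} (h0 : ∀ y, (Φ f0).1 y = 0) (y : Y) :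
    ∃ n m : ℕ, 1 ≤ n ∧ ∃ x : Fin n → X, (x, y) ∈ EE Φ f0 n m ∧ ∃ O : Set (Fin n → X), IsOpen O ∧
      x ∈ O ∧ ∀ x' ∈ O, (x', y) ∈ EE Φ f0 n m → x' = x := by
  classical
  let Q : Finset X → ℕ → Prop := fun A m => ∀ f : Cp X,
    (∀ a ∈ A, |f.1 a - f0.1 a| < 1 / ((m : ℝ) + 1)) → |(Φ f).1 y| ≤ 1
  have hev : Continuous (fun f : Cp X => (Φ f).1 y) := (Cp_eval_continuous y).comp hc
  have hex : ∃ n, ∃ A m, A.card = n ∧ Q A m := by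
    have hO : IsOpen {f : Cp X | |(Φ f).1 y| < 1} := isOpen_lt hev.abs continuous_const
    obtain ⟨A, m, hA⟩ := Cp_nhds hO (f := f0) (by simp [h0])
    exact ⟨_, A, m, rfl, fun f hf => le_of_lt (hA f hf)⟩
  let n := Nat.find hex
  obtain ⟨A, m, hAn, hQ⟩ := Nat.find_spec hex
  have hmin : ∀ A' : Finset X, A'.card < n → ¬ Q A' m := fun A' h hq =>
    Nat.find_min hex h ⟨A', m, rfl, hq⟩
  have hn : 1 ≤ n := by
    by_contra hlt
    have hA0 : A = ∅ := by
      rw [← Finset.card_eq_zero, hAn]; change n = 0; omega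
    obtain ⟨f, hf⟩ := hs ⟨fun _ => 2, continuous_const⟩
    have := hQ f (by simp [hA0])
    rw [hf] at this
    norm_num at this
  let e := A.equivFinOfCardEq hAn
  let x : Fin n → X := fun i => (e.symm i).1
  have hxA : ∀ i, x i ∈ A := fun i => (e.symm i).2
  have hAx : ∀ a ∈ A, ∃ i, x i = a := fun a ha => ⟨e ⟨a, ha⟩, by simp [x]⟩
  -- bad functions
  have hbad : ∀ D : Finset (Fin n), ∃ (f : Cp X) (B : Finset X), D ≠ Finset.univ →
      (∀ i ∈ D, |f.1 (x i) - f0.1 (x i)| < 1 / ((m : ℝ) + 1)) ∧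
      ∀ f' : Cp X, (∀ b ∈ B, f'.1 b = f.1 b) → 1 < |(Φ f').1 y| := by
    intro D
    by_cases hD : D = Finset.univ
    · exact ⟨f0, ∅, fun h => (h hD).elim⟩
    have hlt : (D.image x).card < n := by
      refine Finset.card_image_le.trans_lt ?_
      have := Finset.card_lt_card (Finset.ssubset_univ_iff.2 hD)
      simpa using this
    have := hmin _ hlt
    simp only [Q] at this
    push Not at this
    obtain ⟨f, hf, hf1⟩ := this
    have hO : IsOpen {f : Cp X | 1 < |(Φ f).1 y|} := isOpen_lt continuous_const hev.abs
    obtain ⟨B, r, hB⟩ := Cp_nhds hO (f := f) hf1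
    refine ⟨f, B, fun _ => ⟨fun i hi => hf _ (Finset.mem_image_of_mem x hi), fun f' hf' => ?_⟩⟩
    refine hB f' fun b hb => ?_
    rw [hf' b hb]; simp; positivity
  choose F B hFB using hbad
  let BB : Finset X := A ∪ Finset.univ.biUnion B
  refine ⟨n, m, hn, x, ?_, Set.univ.pi fun i => ((BB.erase (x i) : Finset X) : Set X)ᶜ, ?_, ?_, ?_⟩
  · intro f hf
    apply hQ
    intro a ha
    obtain ⟨i, rfl⟩ := hAx a ha
    exact hf i
  · exact isOpen_set_pi Set.finite_univ fun i _ => (Finset.finite_toSet _).isClosed.isOpen_compl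
  · intro i _; simp
  · intro x' hx' hE
    by_contra hne
    let D : Finset (Fin n) := Finset.univ.filter fun i => x' i = x i
    have hD : D ≠ Finset.univ := by
      intro h
      apply hne
      funext i
      have : i ∈ D := by rw [h]; simp
      simpa [D] using this
    obtain ⟨h1, h2⟩ := hFB D hD
    obtain ⟨f', hf1, hf2⟩ := exists_interp (F D) f0 BB.finite_toSet
      (T := x' '' {i | i ∉ D}) (Set.toFinite _) (by
        rw [Set.disjoint_right]
        rintro _ ⟨i, hi, rfl⟩ hb
        have h := hx' i trivial
        simp only [Finset.coe_erase, Set.mem_compl_iff, Set.mem_diff, Set.mem_singleton_iff,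
          not_and, not_not] at h
        exact hi (by simpa [D] using h hb))
    have hgt := h2 f' (fun b hb => hf1 b (by
      simp only [BB, Finset.coe_union, Set.mem_union, Finset.mem_coe, Finset.mem_biUnion]
      exact Or.inr ⟨D, Finset.mem_univ _, hb⟩))
    have hle := hE f' (by
      intro i
      by_cases hi : i ∈ D
      · have hxi : x' i = x i := by simpa [D] using hi
        simp only [hxi]
        rw [hf1 (x i) (by simp [BB, hxA i])]
        exact h1 i hi
      · simp only
        rw [hf2 (x' i) ⟨i, hi, rfl⟩]
        simp; positivity)
    exact absurd hle (not_le.2 hgt)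

/-- If `X`, `Y` are σ-compact metrizable spaces, `C_p(Y)` is the image of `C_p(X)` under
a continuous open mapping, `k ≥ 2`, and every finite power `X^n` (`n ≥ 1`) is a
`k`-`C`-space, then `Y` is a `k`-`C`-space. -/
theorem kC_preserved {X Y : Type*}
    [TopologicalSpace X] [SigmaCompactSpace X] [TopologicalSpace.MetrizableSpace X]
    [TopologicalSpace Y] [SigmaCompactSpace Y] [TopologicalSpace.MetrizableSpace Y]
    (k : ℕ) (hk : 2 ≤ k)
    (hΦ : ∃ Φ : Cp X → Cp Y, Continuous Φ ∧ IsOpenMap Φ ∧ Function.Surjective Φ)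
    (hX : ∀ n : ℕ, 1 ≤ n → IsKCSpace k (Fin n → X)) :
    IsKCSpace k Y := by
  obtain ⟨Φ, hc, ho, hs⟩ := hΦ
  obtain ⟨f0, hf0⟩ := hs ⟨fun _ => 0, continuous_const⟩
  have h0 : ∀ y, (Φ f0).1 y = 0 := fun y => by rw [hf0]
  apply KCS.isKCSpace
  letI := TopologicalSpace.metrizableSpaceMetric X
  letI := TopologicalSpace.metrizableSpaceMetric Y
  haveI : SecondCountableTopology X := EMetric.secondCountable_of_sigmaCompact X
  haveI : SecondCountableTopology Y := EMetric.secondCountable_of_sigmaCompact Y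
  let L : ∀ (n m s : ℕ) (b : TopologicalSpace.countableBasis ((Fin n → X) × Y)),
      Set ((Fin n → X) × Y) := fun n m s b =>
    (compactCovering ((Fin n → X) × Y) s ∩ closure b.1) ∩ EE Φ f0 n m
  have hL : ∀ n m s b, IsCompact (L n m s b) := fun n m s b =>
    ((isCompact_compactCovering _ s).inter_right isClosed_closure).inter_right (EE_closed _ _ _ _)
  let S : ∀ (n m s : ℕ) (b : TopologicalSpace.countableBasis ((Fin n → X) × Y)), Set Y :=
    fun n m s b => {y | ∃ e ∈ L n m s b, e.2 = y ∧ ∀ e' ∈ L n m s b, e'.2 = y → e' = e}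
  have hS : ∀ n m s b, 1 ≤ n → KCS k (S n m s b) := by
    intro n m s b hn
    refine kcs_singleton_fibres continuous_snd (hL n m s b) ?_
    refine kcs_finite_to_one hk continuous_fst (hL n m s b) (hX n hn).kcs ?_
    intro w
    refine (EE_finite ho h0 n m w).subset ?_
    rintro z ⟨hz, hw⟩
    exact ⟨hz.2, hw⟩
  have hU : KCS k (⋃ n : ℕ, ⋃ m : ℕ, ⋃ s : ℕ, ⋃ b, S (n + 1) m s b) := by
    refine KCS.iUnion fun n => KCS.iUnion fun m => KCS.iUnion fun s => ?_
    haveI : Countable (TopologicalSpace.countableBasis ((Fin (n + 1) → X) × Y)) :=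
      (TopologicalSpace.countable_countableBasis _).to_subtype
    exact KCS.iUnion fun b => hS (n + 1) m s b (by omega)
  refine hU.mono ?_
  intro y _
  obtain ⟨n, m, hn, x, hx, O, hO, hxO, hiso⟩ := EE_isolated hc hs h0 y
  obtain ⟨n, rfl⟩ : ∃ n', n = n' + 1 := ⟨n - 1, by omega⟩
  obtain ⟨s, hs'⟩ := exists_mem_compactCovering (x, y)
  obtain ⟨b, hb, hxb, hbO⟩ := (TopologicalSpace.isBasis_countableBasis
    ((Fin (n + 1) → X) × Y)).exists_closure_subset
    (h := (hO.preimage continuous_fst).mem_nhds (show (x, y) ∈ Prod.fst ⁻¹' O from hxO))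
  simp only [Set.mem_iUnion]
  refine ⟨n, m, s, ⟨b, hb⟩, (x, y), ⟨⟨hs', subset_closure hxb⟩, hx⟩, rfl, ?_⟩
  rintro ⟨x', y'⟩ ⟨⟨-, h1⟩, h2⟩ rfl
  rw [hiso x' (hbO h1) h2]
end
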